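/- arXiv:2506.00897 — 2 statements merged into one kernel-verified Lean document; each statement's English description precedes it below -/
import Mathlib

section
/- The real parts of the vector fields Z₋, Z'₋, Z₊, Z'₊ are tangent to M: for each of these four vector fields X and every p ∈ E with F(p) = 0, one has (fderiv ℝ F p)(X(p)) = 0. -/
open Complex

noncomputable section

/-- `E = ℂ^{k+2}` with coordinates `(w, z₀, z₁, …, z_k)`:
index `0` is `w` and index `h+1` is `z_h` for `0 ≤ h ≤ k`. -/
abbrev Ec (k : ℕ) := Fin (k + 2) → ℂ

/-- The defining function `F(p) = Re w - 2 ∑_{h=1}^{k} Re (z₀^h conj z_h)`. -/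
def Fdef (k : ℕ) (p : Ec k) : ℝ :=
  (p 0).re - 2 * ∑ h : Fin k, ((p 1) ^ ((h : ℕ) + 1) * (starRingEnd ℂ) (p h.succ.succ)).re

/-- The real part of the vector field `X` is tangent to `M = {F = 0}`. -/
def Tangent (k : ℕ) (X : Ec k → Ec k) : Prop :=
  ∀ p : Ec k, Fdef k p = 0 → fderiv ℝ (Fdef k) p (X p) = 0

/-- The Lie bracket of vector fields over `ℂ`. -/
def lb (k : ℕ) (X Y : Ec k → Ec k) : Ec k → Ec k :=
  fun p => fderiv ℂ Y p (X p) - fderiv ℂ X p (Y p)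

/-- The Lie bracket of vector fields over `ℝ`. -/
def lbR (k : ℕ) (X Y : Ec k → Ec k) : Ec k → Ec k :=
  fun p => fderiv ℝ Y p (X p) - fderiv ℝ X p (Y p)

/-- `Z_h = z₀^h ∂_w + (1/2) ∂_{z_h}`. -/
def Zf (k h : ℕ) : Ec k → Ec k := fun p m =>
  if (m : ℕ) = 0 then (p 1) ^ h else if (m : ℕ) = h + 1 then 1 / 2 else 0

/-- `Z'_h = -i z₀^h ∂_w + (i/2) ∂_{z_h}`. -/
def Zf' (k h : ℕ) : Ec k → Ec k := fun p m =>
  if (m : ℕ) = 0 then -I * (p 1) ^ h else if (m : ℕ) = h + 1 then I / 2 else 0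

/-- `W = i ∂_w`. -/
def Wf (k : ℕ) : Ec k → Ec k := fun _ m => if (m : ℕ) = 0 then I else 0

/-- `A_{h,j} = (1/2) z₀^h ∂_{z_j} - (1/2) z₀^j ∂_{z_h}`. -/
def Af (k h j : ℕ) : Ec k → Ec k := fun p m =>
  if (m : ℕ) = j + 1 then (1 / 2) * (p 1) ^ h
  else if (m : ℕ) = h + 1 then -(1 / 2) * (p 1) ^ j else 0

/-- `A'_{h,j} = -(i/2) z₀^h ∂_{z_j} - (i/2) z₀^j ∂_{z_h}`. -/
def Af' (k h j : ℕ) : Ec k → Ec k := fun p m =>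
  if (m : ℕ) = j + 1 then -(I / 2) * (p 1) ^ h
  else if (m : ℕ) = h + 1 then -(I / 2) * (p 1) ^ j else 0

/-- `A'_h = i z₀^h ∂_{z_h}`. -/
def Ahf (k h : ℕ) : Ec k → Ec k := fun p m =>
  if (m : ℕ) = h + 1 then I * (p 1) ^ h else 0

/-- The `W`-family of `(k+1)²` vector fields. -/
def WFamily (k : ℕ) : Set (Ec k → Ec k) :=
  {X | (∃ h : ℕ, 1 ≤ h ∧ h ≤ k ∧ X = Zf k h) ∨
       (∃ h : ℕ, 1 ≤ h ∧ h ≤ k ∧ X = Zf' k h) ∨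
       X = Wf k ∨
       (∃ h j : ℕ, 1 ≤ h ∧ h < j ∧ j ≤ k ∧ X = Af k h j) ∨
       (∃ h j : ℕ, 1 ≤ h ∧ h < j ∧ j ≤ k ∧ X = Af' k h j) ∨
       (∃ h : ℕ, 1 ≤ h ∧ h ≤ k ∧ X = Ahf k h)}

/-- `𝓔 = (k+1) w ∂_w + z₀ ∂_{z_0} + ∑ (k+1-h) z_h ∂_{z_h}`. -/
def Ef (k : ℕ) : Ec k → Ec k := fun p m =>
  if (m : ℕ) = 0 then ((k : ℂ) + 1) * p m
  else if (m : ℕ) = 1 then p m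
  else ((k + 2 - (m : ℕ) : ℕ) : ℂ) * p m

/-- `𝓙 = -i z₀ ∂_{z_0} - i ∑ h z_h ∂_{z_h}`. -/
def Jf (k : ℕ) : Ec k → Ec k := fun p m =>
  if (m : ℕ) = 0 then 0
  else if (m : ℕ) = 1 then -I * p m
  else -I * (((m : ℕ) - 1 : ℕ) : ℂ) * p m

/-- `𝓚 = -z₀ ∂_{z_0} + ∑ h z_h ∂_{z_h}`. -/
def Kf (k : ℕ) : Ec k → Ec k := fun p m =>
  if (m : ℕ) = 0 then 0
  else if (m : ℕ) = 1 then -p m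
  else (((m : ℕ) - 1 : ℕ) : ℂ) * p m

/-- `𝓗 = 2k w ∂_w + 2 z₀ ∂_{z_0} + ∑ 2(k-h) z_h ∂_{z_h}`. -/
def Hf (k : ℕ) : Ec k → Ec k := fun p m =>
  if (m : ℕ) = 0 then 2 * (k : ℂ) * p m
  else if (m : ℕ) = 1 then 2 * p m
  else ((2 * (k + 1 - (m : ℕ)) : ℕ) : ℂ) * p m

/-- `Z₋`. -/
def Zmf (k : ℕ) : Ec k → Ec k := fun p m =>
  if (m : ℕ) = 0 then 2 * (k : ℂ) * p 2
  else if (m : ℕ) = 1 then (k : ℂ)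
  else if hm : (m : ℕ) ≤ k then
    -(k : ℂ) * ((m : ℕ) : ℂ) * p ⟨(m : ℕ) + 1, by omega⟩
  else 0

/-- `Z'₋`. -/
def Zmf' (k : ℕ) : Ec k → Ec k := fun p m =>
  if (m : ℕ) = 0 then -2 * I * (k : ℂ) * p 2
  else if (m : ℕ) = 1 then I * (k : ℂ)
  else if hm : (m : ℕ) ≤ k then
    I * (k : ℂ) * ((m : ℕ) : ℂ) * p ⟨(m : ℕ) + 1, by omega⟩
  else 0

/-- `Z₊`. -/
def Zpf (k : ℕ) : Ec k → Ec k := fun p m =>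
  if (m : ℕ) = 0 then p 1 * p 0
  else if (m : ℕ) = 1 then (p 1) ^ 2 / (k : ℂ)
  else if (m : ℕ) = 2 then p 2 * p 1 - p 0 / 2
  else p m * p 1 +
    (1 - (((m : ℕ) - 2 : ℕ) : ℂ) / (k : ℂ)) * p ⟨(m : ℕ) - 1, by have := m.isLt; omega⟩

/-- `Z'₊`. -/
def Zpf' (k : ℕ) : Ec k → Ec k := fun p m =>
  if (m : ℕ) = 0 then -I * p 1 * p 0
  else if (m : ℕ) = 1 then -I * (p 1) ^ 2 / (k : ℂ)
  else if (m : ℕ) = 2 then -I * p 2 * p 1 - I / 2 * p 0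
  else -I * p m * p 1 +
    I * (1 - (((m : ℕ) - 2 : ℕ) : ℂ) / (k : ℂ)) * p ⟨(m : ℕ) - 1, by have := m.isLt; omega⟩

end

theorem hasFDerivAt_Fdef (k : ℕ) (p : Ec k) :
    HasFDerivAt (Fdef k)
      (reCLM.comp (ContinuousLinearMap.proj 0) - (2 : ℝ) • ∑ h : Fin k, reCLM.comp
        ((p 1) ^ ((h : ℕ) + 1) • (conjCLE.toContinuousLinearMap.comp
            (ContinuousLinearMap.proj (R := ℝ) (φ := fun _ : Fin (k + 2) => ℂ) h.succ.succ)) +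
          (starRingEnd ℂ (p h.succ.succ)) • ((((h : ℕ) + 1 : ℕ) • (p 1) ^ (h : ℕ)) •
            (ContinuousLinearMap.proj (R := ℝ) (φ := fun _ : Fin (k + 2) => ℂ) 1)))) p := by
  have hproj (i : Fin (k + 2)) : HasFDerivAt (fun q : Ec k => q i)
      (ContinuousLinearMap.proj (R := ℝ) (φ := fun _ : Fin (k + 2) => ℂ) i) p :=
    (ContinuousLinearMap.proj (R := ℝ) (φ := fun _ : Fin (k + 2) => ℂ) i).hasFDerivAt
  refine (reCLM.hasFDerivAt.comp p (hproj 0)).sub (HasFDerivAt.const_mul ?_ 2)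
  refine HasFDerivAt.fun_sum fun h _ => ?_
  have hmul := ((hproj 1).pow ((h : ℕ) + 1)).mul
    (conjCLE.toContinuousLinearMap.hasFDerivAt.comp p (hproj h.succ.succ))
  exact reCLM.hasFDerivAt.comp p hmul

theorem fderiv_Fdef_apply (k : ℕ) (p v : Ec k) :
    fderiv ℝ (Fdef k) p v =
      (v 0 - 2 * (∑ h : Fin k, ((h : ℕ) + 1) * (p 1) ^ (h : ℕ) * v 1 *
          starRingEnd ℂ (p h.succ.succ) +
        ∑ h : Fin k, (p 1) ^ ((h : ℕ) + 1) * starRingEnd ℂ (v h.succ.succ))).re := by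
  rw [(hasFDerivAt_Fdef k p).fderiv, ← Finset.sum_add_distrib, sub_re, ← ofReal_ofNat,
    re_ofReal_mul, re_sum]
  simp only [_root_.sub_apply, _root_.smul_apply,
    _root_.sum_apply, ContinuousLinearMap.comp_apply, ContinuousLinearMap.proj_apply,
    _root_.add_apply, smul_eq_mul, reCLM_apply]
  congr 2
  refine Finset.sum_congr rfl fun h _ => congrArg re ?_
  simp
  ring

theorem Fdef_eq_re (k : ℕ) (p : Ec k) : Fdef k p = (p 0).re -
    2 * (∑ h : Fin k, (p 1) ^ ((h : ℕ) + 1) * starRingEnd ℂ (p h.succ.succ)).re := by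
  rw [Fdef, re_sum]

theorem tangent_Zmf (n : ℕ) : Tangent (n + 1) (Zmf (n + 1)) := by
  intro p _
  rw [fderiv_Fdef_apply, Fin.sum_univ_succ, Fin.sum_univ_castSucc (n := n)]
  have h2 (h : Fin n) : Zmf (n + 1) p h.castSucc.succ.succ =
      -((n : ℂ) + 1) * ((h : ℕ) + 2) * p h.succ.succ.succ := by
    simp [Zmf, add_assoc, one_add_one_eq_two]
    left; rfl
  have hlast : Zmf (n + 1) p (Fin.last n).succ.succ = 0 := by simp [Zmf]
  have h0 : Zmf (n + 1) p 0 = 2 * ((n : ℂ) + 1) * p (0 : Fin (n + 1)).succ.succ := by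
    simp [Zmf]
  have h1 : Zmf (n + 1) p 1 = (n : ℂ) + 1 := by simp [Zmf]
  simp only [h2, hlast, h0, h1, map_mul, map_neg, map_add, map_natCast, map_one, map_ofNat]
  have key : ∑ h : Fin n, (p 1) ^ ((h.castSucc : ℕ) + 1) * (-((n : ℂ) + 1) * ((h : ℕ) + 2) *
      starRingEnd ℂ (p h.succ.succ.succ)) = -∑ h : Fin n, (((h.succ : ℕ) : ℂ) + 1) *
      (p 1) ^ (h.succ : ℕ) * (n + 1) * starRingEnd ℂ (p h.succ.succ.succ) := by
    rw [← Finset.sum_neg_distrib]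
    refine Finset.sum_congr rfl fun h _ => ?_
    simp only [Fin.val_castSucc, Fin.val_succ]
    push_cast
    ring
  rw [key]
  simp
  ring

theorem tangent_Zmf' (n : ℕ) : Tangent (n + 1) (Zmf' (n + 1)) := by
  intro p _
  rw [fderiv_Fdef_apply, Fin.sum_univ_succ, Fin.sum_univ_castSucc (n := n)]
  have h2 (h : Fin n) : Zmf' (n + 1) p h.castSucc.succ.succ =
      I * ((n : ℂ) + 1) * ((h : ℕ) + 2) * p h.succ.succ.succ := by
    simp [Zmf', add_assoc, one_add_one_eq_two]
    left; rfl
  have hlast : Zmf' (n + 1) p (Fin.last n).succ.succ = 0 := by simp [Zmf']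
  have h0 : Zmf' (n + 1) p 0 = -2 * I * ((n : ℂ) + 1) * p (0 : Fin (n + 1)).succ.succ := by
    simp [Zmf']
  have h1 : Zmf' (n + 1) p 1 = I * ((n : ℂ) + 1) := by simp [Zmf']
  simp only [h2, hlast, h0, h1, map_mul, map_add, map_natCast, map_one, map_ofNat, conj_I]
  have key : ∑ h : Fin n, (p 1) ^ ((h.castSucc : ℕ) + 1) * (-I * ((n : ℂ) + 1) * ((h : ℕ) + 2) *
      starRingEnd ℂ (p h.succ.succ.succ)) = -∑ h : Fin n, (((h.succ : ℕ) : ℂ) + 1) *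
      (p 1) ^ (h.succ : ℕ) * (I * (n + 1)) * starRingEnd ℂ (p h.succ.succ.succ) := by
    rw [← Finset.sum_neg_distrib]
    refine Finset.sum_congr rfl fun h _ => ?_
    simp only [Fin.val_castSucc, Fin.val_succ]
    push_cast
    ring
  rw [key]
  simp
  ring

theorem tangent_Zpf (n : ℕ) : Tangent (n + 1) (Zpf (n + 1)) := by
  intro p hp
  have hn : (n : ℂ) + 1 ≠ 0 := Nat.cast_add_one_ne_zero n
  rw [fderiv_Fdef_apply, Fin.sum_univ_castSucc, Fin.sum_univ_succ (n := n)]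
  rw [Fdef_eq_re] at hp
  have h2 (h : Fin n) : Zpf (n + 1) p h.succ.succ.succ = p h.succ.succ.succ * p 1 +
      (1 - ((h : ℕ) + 1) / ((n : ℂ) + 1)) * p h.castSucc.succ.succ := by
    simp [Zpf]
    left; rfl
  have h0 : Zpf (n + 1) p 0 = p 1 * p 0 := by simp [Zpf]
  have h1 : Zpf (n + 1) p 1 = p 1 ^ 2 / ((n : ℂ) + 1) := by simp [Zpf]
  have h3 : Zpf (n + 1) p (0 : Fin (n + 1)).succ.succ =
      p (0 : Fin (n + 1)).succ.succ * p 1 - p 0 / 2 := rfl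
  simp only [h2, h3, h0, h1, map_mul, map_sub, map_div₀, map_add, map_natCast, map_one, map_ofNat]
  set S := ∑ h : Fin (n + 1), (p 1) ^ ((h : ℕ) + 1) * starRingEnd ℂ (p h.succ.succ) with hS
  have hS1 := hS
  have hS2 := hS
  rw [Fin.sum_univ_castSucc] at hS1
  rw [Fin.sum_univ_succ] at hS2
  have key : (∑ h : Fin n, (((h.castSucc : ℕ) : ℂ) + 1) * (p 1) ^ (h.castSucc : ℕ) *
        (p 1 ^ 2 / ((n : ℂ) + 1)) * starRingEnd ℂ (p h.castSucc.succ.succ)) +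
      ∑ h : Fin n, (p 1) ^ ((h.succ : ℕ) + 1) *
        (starRingEnd ℂ (p h.succ.succ.succ) * starRingEnd ℂ (p 1) +
          (1 - ((h : ℕ) + 1) / ((n : ℂ) + 1)) * starRingEnd ℂ (p h.castSucc.succ.succ)) =
      p 1 * (∑ h : Fin n, (p 1) ^ ((h.castSucc : ℕ) + 1) *
        starRingEnd ℂ (p h.castSucc.succ.succ)) +
      starRingEnd ℂ (p 1) * (∑ h : Fin n, (p 1) ^ ((h.succ : ℕ) + 1) *
        starRingEnd ℂ (p h.succ.succ.succ)) := by
    rw [← Finset.sum_add_distrib, Finset.mul_sum, Finset.mul_sum, ← Finset.sum_add_distrib]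
    refine Finset.sum_congr rfl fun h _ => ?_
    simp only [Fin.val_castSucc, Fin.val_succ]
    ring
  have total : p 1 * p 0 - 2 * (((∑ h : Fin n, (((h.castSucc : ℕ) : ℂ) + 1) *
        (p 1) ^ (h.castSucc : ℕ) *
        (p 1 ^ 2 / ((n : ℂ) + 1)) * starRingEnd ℂ (p h.castSucc.succ.succ)) +
        ((((Fin.last n : Fin (n + 1)) : ℕ) : ℂ) + 1) * (p 1) ^ ((Fin.last n : Fin (n + 1)) : ℕ) *
        (p 1 ^ 2 / ((n : ℂ) + 1)) * starRingEnd ℂ (p (Fin.last n).succ.succ)) +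
      ((p 1) ^ (((0 : Fin (n + 1)) : ℕ) + 1) * (starRingEnd ℂ (p (0 : Fin (n + 1)).succ.succ) *
        starRingEnd ℂ (p 1) - starRingEnd ℂ (p 0) / 2) +
      ∑ h : Fin n, (p 1) ^ ((h.succ : ℕ) + 1) *
        (starRingEnd ℂ (p h.succ.succ.succ) * starRingEnd ℂ (p 1) +
          (1 - ((h : ℕ) + 1) / ((n : ℂ) + 1)) * starRingEnd ℂ (p h.castSucc.succ.succ)))) =
      p 1 * (p 0 + starRingEnd ℂ (p 0)) - 2 * (p 1 + starRingEnd ℂ (p 1)) * S := by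
    have hl : ((n : ℂ) + 1) * (p 1) ^ n * (p 1 ^ 2 / ((n : ℂ) + 1)) = p 1 * p 1 ^ (n + 1) := by
      field_simp
      ring
    simp only [Fin.val_last, Fin.val_zero] at hS1 hS2 ⊢
    rw [hl]
    linear_combination (-2) * key + 2 * p 1 * hS1 + 2 * starRingEnd ℂ (p 1) * hS2
  rw [total, add_conj, add_conj]
  simp
  linear_combination 2 * (p 1).re * hp

theorem tangent_Zpf' (n : ℕ) : Tangent (n + 1) (Zpf' (n + 1)) := by
  intro p hp
  have hn : (n : ℂ) + 1 ≠ 0 := Nat.cast_add_one_ne_zero n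
  rw [fderiv_Fdef_apply, Fin.sum_univ_castSucc, Fin.sum_univ_succ (n := n)]
  rw [Fdef_eq_re] at hp
  have h2 (h : Fin n) : Zpf' (n + 1) p h.succ.succ.succ = -I * p h.succ.succ.succ * p 1 +
      I * (1 - ((h : ℕ) + 1) / ((n : ℂ) + 1)) * p h.castSucc.succ.succ := by
    simp [Zpf']
    left; rfl
  have h0 : Zpf' (n + 1) p 0 = -I * p 1 * p 0 := by simp [Zpf']
  have h1 : Zpf' (n + 1) p 1 = -I * p 1 ^ 2 / ((n : ℂ) + 1) := by simp [Zpf']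
  have h3 : Zpf' (n + 1) p (0 : Fin (n + 1)).succ.succ =
      -I * p (0 : Fin (n + 1)).succ.succ * p 1 - I / 2 * p 0 := rfl
  simp only [h2, h3, h0, h1, map_mul, map_neg, conj_I, neg_neg, map_sub, map_div₀, map_add, map_natCast, map_one, map_ofNat]
  set S := ∑ h : Fin (n + 1), (p 1) ^ ((h : ℕ) + 1) * starRingEnd ℂ (p h.succ.succ) with hS
  have hS1 := hS
  have hS2 := hS
  rw [Fin.sum_univ_castSucc] at hS1
  rw [Fin.sum_univ_succ] at hS2
  have key : (∑ h : Fin n, (((h.castSucc : ℕ) : ℂ) + 1) * (p 1) ^ (h.castSucc : ℕ) *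
        (-I * p 1 ^ 2 / ((n : ℂ) + 1)) * starRingEnd ℂ (p h.castSucc.succ.succ)) +
      ∑ h : Fin n, (p 1) ^ ((h.succ : ℕ) + 1) *
        (I * starRingEnd ℂ (p h.succ.succ.succ) * starRingEnd ℂ (p 1) +
          -I * (1 - ((h : ℕ) + 1) / ((n : ℂ) + 1)) * starRingEnd ℂ (p h.castSucc.succ.succ)) =
      -I * p 1 * (∑ h : Fin n, (p 1) ^ ((h.castSucc : ℕ) + 1) *
        starRingEnd ℂ (p h.castSucc.succ.succ)) +
      I * starRingEnd ℂ (p 1) * (∑ h : Fin n, (p 1) ^ ((h.succ : ℕ) + 1) *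
        starRingEnd ℂ (p h.succ.succ.succ)) := by
    rw [← Finset.sum_add_distrib, Finset.mul_sum, Finset.mul_sum, ← Finset.sum_add_distrib]
    refine Finset.sum_congr rfl fun h _ => ?_
    simp only [Fin.val_castSucc, Fin.val_succ]
    ring
  have total : -I * p 1 * p 0 - 2 * (((∑ h : Fin n, (((h.castSucc : ℕ) : ℂ) + 1) *
        (p 1) ^ (h.castSucc : ℕ) *
        (-I * p 1 ^ 2 / ((n : ℂ) + 1)) * starRingEnd ℂ (p h.castSucc.succ.succ)) +
        ((((Fin.last n : Fin (n + 1)) : ℕ) : ℂ) + 1) * (p 1) ^ ((Fin.last n : Fin (n + 1)) : ℕ) *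
        (-I * p 1 ^ 2 / ((n : ℂ) + 1)) * starRingEnd ℂ (p (Fin.last n).succ.succ)) +
      ((p 1) ^ (((0 : Fin (n + 1)) : ℕ) + 1) * (I * starRingEnd ℂ (p (0 : Fin (n + 1)).succ.succ) *
        starRingEnd ℂ (p 1) - -I / 2 * starRingEnd ℂ (p 0)) +
      ∑ h : Fin n, (p 1) ^ ((h.succ : ℕ) + 1) *
        (I * starRingEnd ℂ (p h.succ.succ.succ) * starRingEnd ℂ (p 1) +
          -I * (1 - ((h : ℕ) + 1) / ((n : ℂ) + 1)) * starRingEnd ℂ (p h.castSucc.succ.succ)))) =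
      -I * p 1 * (p 0 + starRingEnd ℂ (p 0)) + 2 * I * (p 1 - starRingEnd ℂ (p 1)) * S := by
    have hl : ((n : ℂ) + 1) * (p 1) ^ n * (-I * p 1 ^ 2 / ((n : ℂ) + 1)) = -I * p 1 * p 1 ^ (n + 1) := by
      field_simp
      ring
    simp only [Fin.val_last, Fin.val_zero] at hS1 hS2 ⊢
    rw [hl]
    linear_combination (-2) * key + (-2) * I * p 1 * hS1 + 2 * I * starRingEnd ℂ (p 1) * hS2
  rw [total, add_conj, sub_conj]
  simp
  linear_combination 2 * (p 1).im * hp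

/-- The real parts of `Z₋, Z'₋, Z₊, Z'₊` are tangent to `M`. -/
theorem stmt14 (k : ℕ) (hk : 1 ≤ k) :
    Tangent k (Zmf k) ∧ Tangent k (Zmf' k) ∧ Tangent k (Zpf k) ∧ Tangent k (Zpf' k) := by
  obtain ⟨n, rfl⟩ := Nat.exists_eq_add_of_le' hk
  exact ⟨tangent_Zmf n, tangent_Zmf' n, tangent_Zpf n, tangent_Zpf' n⟩
end

section
/- The triple (Z₊, −Z₋, 𝓗) is an sl₂-triple of vector fields: [Z₊, −Z₋] = 𝓗, [Z'₊, −Z'₋] = 𝓗, [𝓗, Z₊] = 2·Z₊ and [𝓗, Z₋] = −2·Z₋ (brackets over ℂ); moreover 𝓗 = (2/(k+1))·(k·𝓔 − 𝓚) as maps E → E. -/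
open Complex

/-- The derivative of a map into a finite product, computed componentwise. -/
theorem fderiv_pi_component {ι : Type*} [Fintype ι] {F : (ι → ℂ) → ι → ℂ} {p : ι → ℂ}
    {G : (ι → ℂ) → ι → ℂ}
    (h : ∀ m, ∃ L : (ι → ℂ) →L[ℂ] ℂ, HasFDerivAt (fun q => F q m) L p ∧ ∀ v, L v = G v m)
    (v : ι → ℂ) : fderiv ℂ F p v = G v := by
  choose L hL hG using h
  rw [(hasFDerivAt_pi.2 hL).fderiv]
  ext m
  simpa using hG m v

theorem fderiv_Hf (k : ℕ) (p v : Ec k) : fderiv ℂ (Hf k) p v = Hf k v := by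
  refine fderiv_pi_component (fun m => ?_) v
  have h := fun i : Fin (k + 2) => hasFDerivAt_apply (𝕜 := ℂ) i p
  unfold Hf
  split_ifs
  · exact ⟨_, (h m).const_mul _, fun v => by simp⟩
  · exact ⟨_, (h m).const_mul _, fun v => by simp⟩
  · exact ⟨_, (h m).const_mul _, fun v => by simp⟩

theorem fderiv_Zmf (k : ℕ) (p v : Ec k) :
    fderiv ℂ (Zmf k) p v = fun m : Fin (k + 2) => if (m : ℕ) = 1 then 0 else Zmf k v m := by
  refine fderiv_pi_component (G := fun v (m : Fin (k + 2)) => if (m : ℕ) = 1 then 0 else Zmf k v m)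
    (fun m => ?_) v
  have h := fun i : Fin (k + 2) => hasFDerivAt_apply (𝕜 := ℂ) i p
  unfold Zmf
  split_ifs
  · omega
  · exact ⟨_, (h 2).const_mul _, fun v => by simp⟩
  · exact ⟨_, hasFDerivAt_const _ _, fun v => by simp⟩
  · exact ⟨_, (h _).const_mul _, fun v => by simp⟩
  · exact ⟨_, hasFDerivAt_const _ _, fun v => by simp⟩

theorem fderiv_Zmf' (k : ℕ) (p v : Ec k) :
    fderiv ℂ (Zmf' k) p v = fun m : Fin (k + 2) => if (m : ℕ) = 1 then 0 else Zmf' k v m := by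
  refine fderiv_pi_component (G := fun v (m : Fin (k + 2)) => if (m : ℕ) = 1 then 0 else Zmf' k v m)
    (fun m => ?_) v
  have h := fun i : Fin (k + 2) => hasFDerivAt_apply (𝕜 := ℂ) i p
  unfold Zmf'
  split_ifs
  · omega
  · exact ⟨_, (h 2).const_mul _, fun v => by simp⟩
  · exact ⟨_, hasFDerivAt_const _ _, fun v => by simp⟩
  · exact ⟨_, (h _).const_mul _, fun v => by simp⟩
  · exact ⟨_, hasFDerivAt_const _ _, fun v => by simp⟩

/-- The directional derivative of `Z₊` at `p` along `v`. -/
noncomputable def ZpfDeriv (k : ℕ) (p v : Ec k) : Ec k := fun m =>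
  if (m : ℕ) = 0 then v 1 * p 0 + p 1 * v 0
  else if (m : ℕ) = 1 then 2 * p 1 * v 1 / (k : ℂ)
  else if (m : ℕ) = 2 then v 2 * p 1 + p 2 * v 1 - v 0 / 2
  else v m * p 1 + p m * v 1 +
    (1 - (((m : ℕ) - 2 : ℕ) : ℂ) / (k : ℂ)) * v ⟨(m : ℕ) - 1, by have := m.isLt; omega⟩

theorem fderiv_Zpf (k : ℕ) (p v : Ec k) :
    fderiv ℂ (Zpf k) p v = ZpfDeriv k p v := by
  refine fderiv_pi_component (fun m => ?_) v
  have h := fun i : Fin (k + 2) => hasFDerivAt_apply (𝕜 := ℂ) i p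
  unfold ZpfDeriv Zpf
  split_ifs
  · exact ⟨_, (h 1).mul (h 0), fun v => by simp; ring⟩
  · simp only [div_eq_mul_inv]
    exact ⟨_, ((h 1).pow 2).mul_const _, fun v => by simp; ring⟩
  · simp only [div_eq_mul_inv]
    exact ⟨_, ((h 2).mul (h 1)).sub ((h 0).mul_const _), fun v => by simp; ring⟩
  · exact ⟨_, ((h m).mul (h 1)).add ((h _).const_mul _), fun v => by simp; ring⟩

/-- The directional derivative of `Z'₊` at `p` along `v`. -/
noncomputable def ZpfDeriv' (k : ℕ) (p v : Ec k) : Ec k := fun m =>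
  if (m : ℕ) = 0 then -I * (v 1 * p 0 + p 1 * v 0)
  else if (m : ℕ) = 1 then -I * (2 * p 1 * v 1) / (k : ℂ)
  else if (m : ℕ) = 2 then -I * (v 2 * p 1 + p 2 * v 1) - I / 2 * v 0
  else -I * (v m * p 1 + p m * v 1) +
    I * (1 - (((m : ℕ) - 2 : ℕ) : ℂ) / (k : ℂ)) * v ⟨(m : ℕ) - 1, by have := m.isLt; omega⟩

theorem fderiv_Zpf' (k : ℕ) (p v : Ec k) :
    fderiv ℂ (Zpf' k) p v = ZpfDeriv' k p v := by
  refine fderiv_pi_component (fun m => ?_) v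
  have h := fun i : Fin (k + 2) => hasFDerivAt_apply (𝕜 := ℂ) i p
  unfold ZpfDeriv' Zpf'
  split_ifs
  · exact ⟨_, ((h 1).const_mul (-I)).mul (h 0), fun v => by simp; ring⟩
  · simp only [div_eq_mul_inv]
    exact ⟨_, (((h 1).pow 2).const_mul (-I)).mul_const _, fun v => by simp; ring⟩
  · exact ⟨_, (((h 2).const_mul (-I)).mul (h 1)).sub ((h 0).const_mul _),
      fun v => by simp; ring⟩
  · exact ⟨_, (((h m).const_mul (-I)).mul (h 1)).add ((h _).const_mul _),
      fun v => by simp; ring⟩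

theorem Fin.two_eq_mk {k : ℕ} (hk : 1 ≤ k) : (2 : Fin (k + 2)) = ⟨2, by omega⟩ := by
  ext; simp; omega

/-- Split the coordinates `(w, z₀, z₁, …)` into `w`, `z₀`, `z₁` and `z_{n+2}`. -/
theorem funext_coords {k : ℕ} (hk : 1 ≤ k) {u v : Ec k} (h0 : u 0 = v 0) (h1 : u 1 = v 1)
    (h2 : u 2 = v 2) (h3 : ∀ n (hn : n + 3 < k + 2), u ⟨n + 3, hn⟩ = v ⟨n + 3, hn⟩) :
    u = v := by
  rw [Fin.two_eq_mk hk] at h2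
  ext ⟨m, hm⟩
  match m with
  | 0 => exact h0
  | 1 => exact h1
  | 2 => exact h2
  | n + 3 => exact h3 n hm

theorem lb_neg_right (k : ℕ) (X Y : Ec k → Ec k) (p : Ec k) :
    lb k X (-Y) p = fderiv ℂ X p (Y p) - fderiv ℂ Y p (X p) := by
  simp only [lb, fderiv_neg, Pi.neg_apply, map_neg, neg_apply]
  ring

/-- `(Z₊, -Z₋, 𝓗)` is an `sl₂`-triple, and `𝓗 = (2/(k+1))·(k𝓔 - 𝓚)`. -/
theorem stmt16 (k : ℕ) (hk : 1 ≤ k) :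
    lb k (Zpf k) (-Zmf k) = Hf k ∧
    lb k (Zpf' k) (-Zmf' k) = Hf k ∧
    lb k (Hf k) (Zpf k) = (2 : ℂ) • Zpf k ∧
    lb k (Hf k) (Zmf k) = (-2 : ℂ) • Zmf k ∧
    Hf k = ((2 : ℂ) / ((k : ℂ) + 1)) • ((k : ℂ) • Ef k - Kf k) := by
  have hk0 : (k : ℂ) ≠ 0 := by exact_mod_cast (by omega : k ≠ 0)
  have hk1 : (k : ℂ) + 1 ≠ 0 := by exact_mod_cast (by omega : k + 1 ≠ 0)
  have e2 := Fin.two_eq_mk hk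
  refine ⟨?_, ?_, ?_, ?_, ?_⟩
  · funext p
    rw [lb_neg_right, fderiv_Zpf, fderiv_Zmf]
    refine funext_coords hk ?_ ?_ ?_ fun n hn => ?_
    · simp [Zmf, Zpf, ZpfDeriv, Hf, e2]; ring
    · simp [Zmf, Zpf, ZpfDeriv, Hf, e2]; field_simp
    · rcases hk.eq_or_lt with rfl | hk2
      · simp [Zmf, Zpf, ZpfDeriv, Hf]
      · obtain ⟨d, rfl⟩ := Nat.exists_eq_add_of_le' hk2
        simp [Zmf, Zpf, ZpfDeriv, Hf, e2] at hk0 ⊢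
        field_simp
        ring
    · have e3 : ∀ h, p ⟨n + 2 + 1, h⟩ = p ⟨n + 3, hn⟩ := fun _ => rfl
      obtain ⟨d, rfl⟩ := Nat.exists_eq_add_of_le' (by omega : n + 2 ≤ k)
      rcases d with _ | d
      · simp [Zmf, Zpf, ZpfDeriv, Hf, e2, e3] at hk0 ⊢
        field_simp
        ring
      · have h3 : n + 3 ≤ d + 1 + (n + 2) := by omega
        simp [Zmf, Zpf, ZpfDeriv, Hf, e2, e3, h3] at hk0 ⊢
        field_simp
        ring
  · funext p
    rw [lb_neg_right, fderiv_Zpf', fderiv_Zmf']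
    refine funext_coords hk ?_ ?_ ?_ fun n hn => ?_
    · simp [Zmf', Zpf', ZpfDeriv', Hf, e2]; ring_nf; simp
    · simp [Zmf', Zpf', ZpfDeriv', Hf, e2]; field_simp; simp
    · rcases hk.eq_or_lt with rfl | hk2
      · simp [Zmf', Zpf', ZpfDeriv', Hf]; ring
      · obtain ⟨d, rfl⟩ := Nat.exists_eq_add_of_le' hk2
        simp [Zmf', Zpf', ZpfDeriv', Hf, e2] at hk0 ⊢
        field_simp
        ring_nf; simp
    · have e3 : ∀ h, p ⟨n + 2 + 1, h⟩ = p ⟨n + 3, hn⟩ := fun _ => rfl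
      obtain ⟨d, rfl⟩ := Nat.exists_eq_add_of_le' (by omega : n + 2 ≤ k)
      rcases d with _ | d
      · simp [Zmf', Zpf', ZpfDeriv', Hf, e2, e3] at hk0 ⊢
        field_simp
        ring_nf
      · have h3 : n + 3 ≤ d + 1 + (n + 2) := by omega
        simp [Zmf', Zpf', ZpfDeriv', Hf, e2, e3, h3] at hk0 ⊢
        field_simp
        ring_nf; simp
  · funext p
    simp only [lb, fderiv_Zpf, fderiv_Hf]
    refine funext_coords hk ?_ ?_ ?_ fun n hn => ?_
    · simp [Zpf, ZpfDeriv, Hf]; ring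
    · simp [Zpf, ZpfDeriv, Hf]; ring
    · simp [Zpf, ZpfDeriv, Hf, e2, Nat.cast_sub hk]; ring
    · obtain ⟨d, rfl⟩ := Nat.exists_eq_add_of_le' (by omega : n + 2 ≤ k)
      have c : d + (n + 2) - (n + 1) = d + 1 := by omega
      simp [Zpf, ZpfDeriv, Hf, c]; ring
  · funext p
    simp only [lb, fderiv_Zmf, fderiv_Hf]
    refine funext_coords hk ?_ ?_ ?_ fun n hn => ?_
    · simp [Zmf, Hf, e2, Nat.cast_sub hk]; ring
    · simp [Zmf, Hf]
    · simp [Zmf, Hf, e2]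
      split_ifs with h
      · simp [Nat.cast_sub hk, Nat.cast_sub h]; ring
      · simp
    · simp [Zmf, Hf]
      split_ifs with h
      · obtain ⟨d, rfl⟩ := Nat.exists_eq_add_of_le' h
        have c : d + (n + 3) - (n + 2) = d + 1 := by omega
        simp [c]; ring
      · simp
  · funext p
    refine funext_coords hk ?_ ?_ ?_ fun n hn => ?_
    · simp [Ef, Kf, Hf]; field_simp
    · simp [Ef, Kf, Hf]; field_simp
    · simp [Ef, Kf, Hf, e2, Nat.cast_sub hk]; field_simp; ring
    · obtain ⟨d, rfl⟩ := Nat.exists_eq_add_of_le' (by omega : n + 2 ≤ k)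
      have c : d + (n + 2) - (n + 1) = d + 1 := by omega
      simp [Ef, Kf, Hf, c] at hk1 ⊢; field_simp; ring
end
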